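/- Let n ≥ 1 be an integer, let p ∈ ℂ with 0 < |p| < 1, and let t, u_0, u_1, u_2, u_3, z_1, ..., z_n ∈ ℂ, all nonzero, with t^{n−1} u_0 u_1 u_2 u_3 = p. Assume θ(z_i²;p) ≠ 0 for all i, and θ(z_i z_j;p) ≠ 0 and θ(z_i/z_j;p) ≠ 0 for all i < j. Then Σ_{σ ∈ {±1}^n} ∏_{i=1}^{n} ( ∏_{r=0}^{3} θ(u_r z_i^{σ_i};p) )/θ(z_i^{2σ_i};p) · ∏_{1≤i<j≤n} θ(t z_i^{σ_i} z_j^{σ_j};p)/θ(z_i^{σ_i} z_j^{σ_j};p) = ∏_{i=0}^{n−1} θ(t^i u_0 u_1;p) θ(t^i u_0 u_2;p) θ(t^i u_0 u_3;p). -/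

import Mathlib

open scoped BigOperators Real

/-- The theta function `θ(x;p)`. -/
noncomputable def ellTheta (x p : ℂ) : ℂ :=
  ∏' k : ℕ, ((1 - p ^ k * x) * (1 - p ^ (k + 1) / x))

/-- `z^{σ}`: `z` if the sign is `+1` (`true`), `z⁻¹` if the sign is `−1` (`false`). -/
noncomputable def pw (z : ℂ) (b : Bool) : ℂ := if b then z else z⁻¹

open Filter Topology

section ThetaBasics

variable {p : ℂ}

/-- The deviation from `1` of the `k`-th factor of the theta product. -/
noncomputable def thetaDev (p : ℂ) (k : ℕ) (x : ℂ) : ℂ :=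
  (1 - p ^ k * x) * (1 - p ^ (k + 1) / x) - 1

theorem ellTheta_eq_tprod_one_add (x p : ℂ) : ellTheta x p = ∏' k, (1 + thetaDev p k x) := by
  simp [ellTheta, thetaDev]

theorem norm_thetaDev_le (hp1 : ‖p‖ < 1) {x : ℂ} (hx : x ≠ 0) (k : ℕ) :
    ‖thetaDev p k x‖ ≤ ‖p‖ ^ k * (‖x‖ + ‖x‖⁻¹ + 1) := by
  have h : thetaDev p k x = -(p ^ k * x) + -(p ^ k * (p * x⁻¹)) + p ^ k * (p ^ k * p) := by
    unfold thetaDev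
    field_simp
    ring
  have hk : ‖p‖ ^ k ≤ 1 := pow_le_one₀ (norm_nonneg _) hp1.le
  rw [h]
  refine (norm_add₃_le).trans ?_
  simp only [norm_neg, norm_mul, norm_pow, norm_inv]
  rw [mul_add, mul_add]
  gcongr
  · exact mul_le_of_le_one_left (by positivity) hp1.le
  · exact mul_le_one₀ hk (norm_nonneg _) hp1.le

theorem summable_norm_thetaDev (hp1 : ‖p‖ < 1) {x : ℂ} (hx : x ≠ 0) :
    Summable fun k => ‖thetaDev p k x‖ :=
  .of_nonneg_of_le (fun _ => norm_nonneg _) (norm_thetaDev_le hp1 hx)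
    ((summable_geometric_of_lt_one (norm_nonneg _) hp1).mul_right _)

theorem tendsto_thetaProd (hp1 : ‖p‖ < 1) {x : ℂ} (hx : x ≠ 0) :
    Tendsto (fun N => ∏ k ∈ Finset.range N, ((1 - p ^ k * x) * (1 - p ^ (k + 1) / x))) atTop
      (𝓝 (ellTheta x p)) := by
  have := (multipliable_one_add_of_summable (summable_norm_thetaDev hp1 hx)).hasProd
  simpa [thetaDev, ellTheta] using this.tendsto_prod_nat

theorem ellTheta_eq_zero_iff (hp1 : ‖p‖ < 1) {x : ℂ} (hx : x ≠ 0) :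
    ellTheta x p = 0 ↔ ∃ k : ℕ, p ^ k * x = 1 ∨ p ^ (k + 1) = x := by
  constructor
  · intro h
    by_contra! hne
    rw [ellTheta_eq_tprod_one_add] at h
    refine tprod_one_add_ne_zero_of_summable (fun k => ?_) (summable_norm_thetaDev hp1 hx) h
    rw [thetaDev, add_sub_cancel]
    refine mul_ne_zero (sub_ne_zero.2 (hne k).1.symm) (sub_ne_zero.2 fun h1 => (hne k).2 ?_)
    field_simp at h1
    exact h1.symm
  · rintro ⟨k, hk⟩
    refine tprod_of_exists_eq_zero ⟨k, ?_⟩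
    rcases hk with hk | hk
    · simp [hk]
    · simp [hk, hx]

theorem ellTheta_one (hp1 : ‖p‖ < 1) : ellTheta 1 p = 0 :=
  (ellTheta_eq_zero_iff hp1 one_ne_zero).2 ⟨0, by simp⟩

theorem ellTheta_inv_ne_zero (hp1 : ‖p‖ < 1) {x : ℂ} (hx : x ≠ 0) (h : ellTheta x p ≠ 0) :
    ellTheta x⁻¹ p ≠ 0 := by
  contrapose! h
  rw [ellTheta_eq_zero_iff hp1 (inv_ne_zero hx)] at h
  rw [ellTheta_eq_zero_iff hp1 hx]
  obtain ⟨k, hk | hk⟩ := h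
  · rw [mul_inv_eq_one₀ hx] at hk
    cases k with
    | zero => exact ⟨0, .inl (by simpa using hk.symm)⟩
    | succ k => exact ⟨k, .inr hk⟩
  · exact ⟨k + 1, .inl (by rw [hk, inv_mul_cancel₀ hx])⟩

theorem ellTheta_div_self (hp0 : p ≠ 0) {x : ℂ} (hx : x ≠ 0) :
    ellTheta (p / x) p = ellTheta x p := by
  unfold ellTheta
  congr 1
  ext k
  rw [mul_comm]
  congr 2 <;> (field_simp; ring)

theorem continuousOn_ellTheta (hp1 : ‖p‖ < 1) : ContinuousOn (fun x => ellTheta x p) {0}ᶜ := by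
  intro x hx
  have hx : x ≠ 0 := hx
  have hxn : 0 < ‖x‖ := norm_pos_iff.2 hx
  let K : Set ℂ := {y | ‖x‖ / 2 < ‖y‖ ∧ ‖y‖ < 2 * ‖x‖}
  have hK : IsOpen K :=
    (isOpen_lt continuous_const continuous_norm).inter (isOpen_lt continuous_norm continuous_const)
  have hK0 : ∀ y ∈ K, y ≠ 0 := fun y hy => norm_pos_iff.1 ((by positivity : 0 < ‖x‖ / 2).trans hy.1)
  have hcts : ∀ k, ContinuousOn (thetaDev p k) K := fun k => by
    unfold thetaDev
    exact ((continuousOn_const.sub (continuousOn_const.mul continuousOn_id)).mul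
      (continuousOn_const.sub (continuousOn_const.div continuousOn_id hK0))).sub continuousOn_const
  have hprod := Summable.hasProdLocallyUniformlyOn_nat_one_add (f := thetaDev p) hK
    (u := fun k => ‖p‖ ^ k * (2 * ‖x‖ + (‖x‖ / 2)⁻¹ + 1))
    ((summable_geometric_of_lt_one (norm_nonneg _) hp1).mul_right _)
    (.of_forall fun k y hy => (norm_thetaDev_le hp1 (hK0 y hy) k).trans (by
      gcongr
      · exact hy.2.le
      · exact hy.1.le)) hcts
  have hc := hprod.tendstoLocallyUniformlyOn_finsetRange.continuousOn
    (.of_forall fun N => continuousOn_finsetProd _ fun k _ => continuousOn_const.add (hcts k))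
  have hmem : x ∈ K := ⟨by linarith, by linarith⟩
  simp only [ellTheta_eq_tprod_one_add]
  exact (hc.continuousAt (hK.mem_nhds hmem)).continuousWithinAt

/-- For fixed nonzero `c`, the theta function of `c * s` vanishes only for countably many `s`. -/
theorem countable_ellTheta_mul_eq_zero (hp1 : ‖p‖ < 1) {c : ℂ} (hc : c ≠ 0) :
    {s : ℂ | s ≠ 0 ∧ ellTheta (c * s) p = 0}.Countable := by
  refine ((Set.countable_range fun k : ℕ => (p ^ k * c)⁻¹).union
    (Set.countable_range fun k : ℕ => p ^ (k + 1) / c)).mono ?_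
  rintro s ⟨hs, h⟩
  obtain ⟨k, hk | hk⟩ := (ellTheta_eq_zero_iff hp1 (mul_ne_zero hc hs)).1 h
  · exact .inl ⟨k, inv_eq_of_mul_eq_one_right (by rw [mul_assoc, hk])⟩
  · exact .inr ⟨k, by simp only [hk]; field_simp⟩

end ThetaBasics

section TripleProduct

/-- The `n`-th partial product of `(p;p)_∞`. -/
noncomputable def qPoch (p : ℂ) (n : ℕ) : ℂ := ∏ j ∈ Finset.range n, (1 - p ^ (j + 1))

/-- The reciprocal of `(p;p)_m`, extended by zero to negative `m`. -/
noncomputable def qPochInv (p : ℂ) (m : ℤ) : ℂ := if 0 ≤ m then (qPoch p m.toNat)⁻¹ else 0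

/-- The `k`-th term of the Laurent series of the theta function, up to normalization. -/
noncomputable def thetaTerm (p x : ℂ) (k : ℤ) : ℂ := (-1) ^ k * p ^ (k * (k - 1) / 2) * x ^ k

variable {p : ℂ}

theorem one_sub_pow_ne_zero (hp1 : ‖p‖ < 1) (j : ℕ) : 1 - p ^ (j + 1) ≠ 0 := by
  refine sub_ne_zero.2 fun h => ?_
  have : ‖p‖ ^ (j + 1) < 1 := pow_lt_one₀ (norm_nonneg _) hp1 j.succ_ne_zero
  rw [← norm_pow, ← h, norm_one] at this
  exact lt_irrefl _ this

theorem qPoch_ne_zero (hp1 : ‖p‖ < 1) (n : ℕ) : qPoch p n ≠ 0 :=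
  Finset.prod_ne_zero_iff.2 fun j _ => one_sub_pow_ne_zero hp1 j

theorem exists_tendsto_qPoch (hp1 : ‖p‖ < 1) : ∃ l ≠ 0, Tendsto (qPoch p) atTop (𝓝 l) := by
  have hs : Summable fun j : ℕ => ‖-p ^ (j + 1)‖ := by
    simp only [norm_neg, norm_mul, norm_pow, pow_succ]
    exact (summable_geometric_of_lt_one (norm_nonneg _) hp1).mul_right _
  refine ⟨∏' j : ℕ, (1 + -p ^ (j + 1)), tprod_one_add_ne_zero_of_summable (fun j => ?_) hs, ?_⟩
  · rw [← sub_eq_add_neg]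
    exact one_sub_pow_ne_zero hp1 j
  · simpa [qPoch, sub_eq_add_neg] using!
      (multipliable_one_add_of_summable hs).hasProd.tendsto_prod_nat

theorem qPochInv_eq (hp1 : ‖p‖ < 1) (m : ℤ) :
    qPochInv p m = (1 - p ^ (m + 1)) * qPochInv p (m + 1) := by
  rcases lt_trichotomy m (-1) with h | rfl | h
  · simp [qPochInv, show ¬ 0 ≤ m by lia, show ¬ 0 ≤ m + 1 by lia]
  · simp [qPochInv]
  · lift m to ℕ using by lia
    have h1 := one_sub_pow_ne_zero hp1 m
    have h2 := qPoch_ne_zero hp1 m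
    have h3 : qPoch p (m + 1) = qPoch p m * (1 - p ^ (m + 1)) := Finset.prod_range_succ _ _
    have h4 : ((m : ℤ) + 1).toNat = m + 1 := by lia
    have h5 : p ^ ((m : ℤ) + 1) = p ^ (m + 1) := by exact_mod_cast zpow_natCast p (m + 1)
    rw [qPochInv, qPochInv, if_pos (by lia), if_pos (by lia), h4, h3, h5, Int.toNat_natCast]
    field_simp

theorem thetaTerm_succ (hp0 : p ≠ 0) {x : ℂ} (hx : x ≠ 0) (k : ℤ) :
    thetaTerm p x (k + 1) = -(p ^ k * x) * thetaTerm p x k := by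
  have h : (k + 1) * (k + 1 - 1) / 2 = k * (k - 1) / 2 + k := by
    rw [← Int.add_mul_ediv_right _ _ two_ne_zero]
    ring_nf
  rw [thetaTerm, thetaTerm, h, zpow_add₀ hp0, zpow_add_one₀ hx, zpow_add_one₀ (by simp)]
  ring

theorem summable_norm_thetaTerm (hp0 : p ≠ 0) (hp1 : ‖p‖ < 1) {x : ℂ} (hx : x ≠ 0) :
    Summable fun k => ‖thetaTerm p x k‖ := by
  have hne : ∀ k, thetaTerm p x k ≠ 0 := fun k => by
    unfold thetaTerm
    simp [zpow_ne_zero, hp0, hx]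
  have hlim : ∀ c : ℝ, Tendsto (fun n : ℕ => ‖p‖ ^ n * c) atTop (𝓝 0) := fun c => by
    simpa using (tendsto_pow_atTop_nhds_zero_of_lt_one (norm_nonneg _) hp1).mul_const c
  refine .of_nat_of_neg ?_ ?_
  · refine summable_of_ratio_test_tendsto_lt_one zero_lt_one
      (.of_forall fun n => norm_ne_zero_iff.2 (hne _)) ((hlim ‖x‖).congr fun n => ?_)
    push_cast
    rw [thetaTerm_succ hp0 hx]
    have := norm_ne_zero_iff.2 (hne n)
    simp
    field_simp
  · refine summable_of_ratio_test_tendsto_lt_one zero_lt_one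
      (.of_forall fun n => norm_ne_zero_iff.2 (hne _)) ((hlim (‖p‖ * ‖x‖⁻¹)).congr fun n => ?_)
    have h := thetaTerm_succ hp0 hx (-((n + 1 : ℕ) : ℤ))
    rw [show -((n + 1 : ℕ) : ℤ) + 1 = -(n : ℤ) by push_cast; ring] at h
    have h1 := norm_ne_zero_iff.2 (hne (-((n + 1 : ℕ) : ℤ)))
    have h2 := norm_ne_zero_iff.2 hp0
    have h3 := norm_ne_zero_iff.2 hx
    rw [h, zpow_neg, zpow_natCast]
    simp only [norm_norm, norm_mul, norm_neg, norm_inv, norm_pow]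
    field_simp
    ring

theorem hasSum_thetaProd (hp0 : p ≠ 0) (hp1 : ‖p‖ < 1) {x : ℂ} (hx : x ≠ 0) (N : ℕ) :
    HasSum (fun k : ℤ => qPoch p (2 * N) * (qPochInv p (N + k) * qPochInv p (N - k) *
        thetaTerm p x k))
      (∏ k ∈ Finset.range N, ((1 - p ^ k * x) * (1 - p ^ (k + 1) / x))) := by
  induction N with
  | zero =>
    have h := hasSum_single (f := fun k : ℤ => qPoch p (2 * 0) * (qPochInv p ((0 : ℕ) + k) *
      qPochInv p ((0 : ℕ) - k) * thetaTerm p x k)) 0 fun k hk => by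
        rcases lt_or_gt_of_ne hk with h | h
        · simp [qPochInv, show ¬ 0 ≤ k by lia]
        · simp [qPochInv, show ¬ k ≤ 0 by lia]
    simpa [qPochInv, qPoch, thetaTerm] using! h
  | succ N ih =>
    rw [Finset.prod_range_succ]
    set T := ∏ k ∈ Finset.range N, ((1 - p ^ k * x) * (1 - p ^ (k + 1) / x))
    have hup := (Equiv.subRight (1 : ℤ)).hasSum_iff.2 (ih.mul_right (-(p ^ N * x)))
    have hdown := (Equiv.addRight (1 : ℤ)).hasSum_iff.2 (ih.mul_right (-(p ^ (N + 1) / x)))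
    have h := ((ih.mul_right (1 + p ^ (2 * N + 1))).add hup).add hdown
    have hval : T * (1 + p ^ (2 * N + 1)) + T * (-(p ^ N * x)) + T * (-(p ^ (N + 1) / x)) =
        T * ((1 - p ^ N * x) * (1 - p ^ (N + 1) / x)) := by
      field_simp
      ring
    rw [hval] at h
    refine h.congr_fun fun k => ?_
    have hQ : qPoch p (2 * (N + 1)) =
        qPoch p (2 * N) * (1 - p ^ (2 * N + 1)) * (1 - p ^ (2 * N + 1 + 1)) := by
      rw [show 2 * (N + 1) = 2 * N + 1 + 1 by ring, qPoch, Finset.prod_range_succ,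
        Finset.prod_range_succ, qPoch]
    set P := p ^ ((N : ℤ) + k) with hP
    set R := p ^ ((N : ℤ) - k) with hR
    have hS : p ^ (2 * N + 1) = P * R * p := by
      rw [hP, hR, ← zpow_add₀ hp0, show (N : ℤ) + k + (N - k) = ((2 * N : ℕ) : ℤ) by push_cast; ring,
        zpow_natCast, pow_succ]
    have e1 : thetaTerm p x (k - 1) * -(p ^ N * x) = R * p * thetaTerm p x k := by
      have h1 := thetaTerm_succ hp0 hx (k - 1)
      have h2 : p ^ N = R * p * p ^ (k - 1) := by
        rw [hR, ← zpow_add_one₀ hp0, ← zpow_add₀ hp0, ← zpow_natCast]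
        ring_nf
      rw [sub_add_cancel] at h1
      rw [h1, h2]
      ring
    have e2 : thetaTerm p x (k + 1) * -(p ^ (N + 1) / x) = P * p * thetaTerm p x k := by
      have h2 : P = p ^ N * p ^ k := by rw [hP, zpow_add₀ hp0, zpow_natCast]
      rw [thetaTerm_succ hp0 hx, h2]
      field_simp
      ring
    have a1 : qPochInv p (N + k) = (1 - P * p) * qPochInv p ((N + 1 : ℕ) + k) := by
      rw [qPochInv_eq hp1, zpow_add_one₀ hp0, ← hP]
      push_cast
      ring_nf
    have a2 : qPochInv p (N + (k - 1)) = (1 - P) * qPochInv p (N + k) := by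
      rw [qPochInv_eq hp1, show (N : ℤ) + (k - 1) + 1 = N + k by ring]
    have a3 : qPochInv p ((N + 1 : ℕ) + k) = qPochInv p (N + (k + 1)) := by
      push_cast
      ring_nf
    have b1 : qPochInv p (N - k) = (1 - R * p) * qPochInv p ((N + 1 : ℕ) - k) := by
      rw [qPochInv_eq hp1, zpow_add_one₀ hp0, ← hR]
      push_cast
      ring_nf
    have b2 : qPochInv p (N - (k + 1)) = (1 - R) * qPochInv p (N - k) := by
      rw [qPochInv_eq hp1, show (N : ℤ) - (k + 1) + 1 = N - k by ring]
    have b3 : qPochInv p ((N + 1 : ℕ) - k) = qPochInv p (N - (k - 1)) := by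
      push_cast
      ring_nf
    simp only [Function.comp_apply, Equiv.subRight_apply, Equiv.coe_addRight]
    rw [a2, b2, ← a3, ← b3, a1, b1, hQ, pow_succ p (2 * N + 1), hS]
    set A := qPochInv p ((N + 1 : ℕ) + k)
    set B := qPochInv p ((N + 1 : ℕ) - k)
    linear_combination -(qPoch p (2 * N) * A * B * (1 - P) * (1 - P * p)) * e1 -
      (qPoch p (2 * N) * A * B * (1 - R) * (1 - R * p)) * e2

/-- The Laurent expansion of the theta function (the Jacobi triple product identity, up to the
value of the constant). -/
theorem exists_ellTheta_eq_tsum (hp0 : p ≠ 0) (hp1 : ‖p‖ < 1) :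
    ∃ C : ℂ, ∀ x ≠ 0, ellTheta x p = C * ∑' k, thetaTerm p x k := by
  obtain ⟨l, hl0, hl⟩ := exists_tendsto_qPoch hp1
  obtain ⟨M, hM⟩ := (Metric.isBounded_range_of_tendsto _ hl).exists_norm_le
  obtain ⟨M', hM'⟩ := (Metric.isBounded_range_of_tendsto _ (hl.inv₀ hl0)).exists_norm_le
  have hM (n : ℕ) : ‖qPoch p n‖ ≤ M := hM _ ⟨n, rfl⟩
  have hM' (n : ℕ) : ‖(qPoch p n)⁻¹‖ ≤ M' := hM' _ ⟨n, rfl⟩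
  have hM0 : 0 ≤ M := (norm_nonneg _).trans (hM 0)
  have hM0' : 0 ≤ M' := (norm_nonneg _).trans (hM' 0)
  have hinv (m : ℤ) : ‖qPochInv p m‖ ≤ M' := by
    unfold qPochInv
    split_ifs
    · exact hM' _
    · simpa
  have hlim (f : ℕ → ℤ) (hf : Tendsto f atTop atTop) :
      Tendsto (fun N => qPochInv p (f N)) atTop (𝓝 l⁻¹) := by
    have hf' : Tendsto (fun N => (f N).toNat) atTop atTop := tendsto_atTop.2 fun m => by
      filter_upwards [hf.eventually_ge_atTop m] with N hN
      lia
    refine ((hl.inv₀ hl0).comp hf').congr' ?_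
    filter_upwards [hf.eventually_ge_atTop 0] with N hN
    simp [qPochInv, hN]
  refine ⟨l * (l⁻¹ * l⁻¹), fun x hx => ?_⟩
  refine tendsto_nhds_unique (tendsto_thetaProd hp1 hx) ?_
  simp only [← (hasSum_thetaProd hp0 hp1 hx _).tsum_eq]
  rw [← tsum_mul_left]
  refine tendsto_tsum_of_dominated_convergence
    ((summable_norm_thetaTerm hp0 hp1 hx).mul_left (M * (M' * M'))) (fun k => ?_)
    (.of_forall fun N k => ?_)
  · rw [mul_assoc]
    refine (hl.comp (tendsto_id.const_mul_atTop' two_pos)).mul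
      (((hlim _ ?_).mul (hlim _ ?_)).mul tendsto_const_nhds)
    · exact tendsto_atTop_add_const_right _ _ tendsto_natCast_atTop_atTop
    · exact tendsto_atTop_add_const_right _ _ tendsto_natCast_atTop_atTop
  · rw [← mul_assoc, norm_mul, norm_mul, norm_mul]
    gcongr
    exacts [hM _, hinv _, hinv _]

end TripleProduct

section RankTwo

/-- Pairs of integers, split according to the parity of their sum. -/
noncomputable def intProdParityEquiv : (ℤ × ℤ) ⊕ (ℤ × ℤ) ≃ ℤ × ℤ where
  toFun := Sum.elim (fun q => (q.1 + q.2, q.1 - q.2)) fun q => (q.1 + q.2 + 1, q.1 - q.2)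
  invFun m := if (m.1 + m.2) % 2 = 0 then .inl ((m.1 + m.2) / 2, (m.1 - m.2) / 2)
    else .inr ((m.1 + m.2 - 1) / 2, (m.1 - m.2 - 1) / 2)
  left_inv := by
    rintro (⟨l, j⟩ | ⟨l, j⟩)
    · have h1 : l + j + (l - j) = 2 * l := by ring
      have h2 : l + j - (l - j) = 2 * j := by ring
      simp [h1, h2]
    · simp [show (l + j + 1 + (l - j)) % 2 ≠ 0 by lia]
      lia
  right_inv := by
    rintro ⟨m, n⟩
    by_cases h : (m + n) % 2 = 0
    · simp [h]
      lia
    · simp [h]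
      lia

variable {p : ℂ}

theorem two_mul_ediv_two_pred (i : ℤ) : i * (i - 1) / 2 * 2 = i * (i - 1) :=
  Int.ediv_mul_cancel (Int.even_mul_pred_self i).two_dvd

theorem thetaTerm_mul_thetaTerm_even (hp0 : p ≠ 0) {k a x : ℂ} (hk : k ≠ 0) (ha : a ≠ 0)
    (hx : x ≠ 0) (l j : ℤ) :
    thetaTerm p (a * x) (l + j) * thetaTerm p (k * a / x) (l - j) =
      (p ^ (l ^ 2 - l) * a ^ (2 * l) * k ^ l) * (p ^ (j ^ 2) * k ^ (-j) * x ^ (2 * j)) := by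
  have h1 := two_mul_ediv_two_pred (l + j)
  have h2 := two_mul_ediv_two_pred (l - j)
  unfold thetaTerm
  have hs : ((-1 : ℂ) ^ (l + j)) * (-1) ^ (l - j) = 1 := by
    rw [← zpow_add₀ (by simp), show l + j + (l - j) = 2 * l by ring, zpow_mul]
    simp
  have hp : p ^ ((l + j) * (l + j - 1) / 2) * p ^ ((l - j) * (l - j - 1) / 2) =
      p ^ (l ^ 2 - l) * p ^ (j ^ 2) := by
    rw [← zpow_add₀ hp0, ← zpow_add₀ hp0]
    congr 1
    linarith
  have hax : (a * x) ^ (l + j) * (k * a / x) ^ (l - j) =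
      a ^ (2 * l) * k ^ l * (k ^ (-j) * x ^ (2 * j)) := by
    rw [mul_zpow, div_zpow, mul_zpow, zpow_add₀ ha, zpow_sub₀ ha, zpow_add₀ hx, zpow_sub₀ hx,
      zpow_sub₀ hk, zpow_neg, two_mul, two_mul, zpow_add₀ ha, zpow_add₀ hx]
    field_simp
  linear_combination (p ^ (l ^ 2 - l) * p ^ (j ^ 2)) * hax +
    ((a * x) ^ (l + j) * (k * a / x) ^ (l - j)) * hp +
    (p ^ ((l + j) * (l + j - 1) / 2) * p ^ ((l - j) * (l - j - 1) / 2) *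
      ((a * x) ^ (l + j) * (k * a / x) ^ (l - j))) * hs

theorem thetaTerm_mul_thetaTerm_odd (hp0 : p ≠ 0) {k a x : ℂ} (hk : k ≠ 0) (ha : a ≠ 0)
    (hx : x ≠ 0) (l j : ℤ) :
    thetaTerm p (a * x) (l + j + 1) * thetaTerm p (k * a / x) (l - j) =
      (-p ^ (l ^ 2) * a ^ (2 * l + 1) * k ^ l) * (p ^ (j ^ 2 + j) * k ^ (-j) * x ^ (2 * j + 1)) := by
  have hpow : p ^ (l ^ 2 - l) * p ^ (j ^ 2) * p ^ (l + j) = p ^ (l ^ 2) * p ^ (j ^ 2 + j) := by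
    rw [← zpow_add₀ hp0, ← zpow_add₀ hp0, ← zpow_add₀ hp0]
    ring_nf
  rw [thetaTerm_succ hp0 (mul_ne_zero ha hx), mul_assoc,
    thetaTerm_mul_thetaTerm_even hp0 hk ha hx, zpow_add_one₀ ha, zpow_add_one₀ hx]
  linear_combination (-(a * x * a ^ (2 * l) * k ^ l * k ^ (-j) * x ^ (2 * j))) * hpow

/-- For fixed `k`, the functions `x ↦ θ(a x) θ(k a / x)` span a space of dimension at most two. -/
theorem exists_theta_pair_basis (hp0 : p ≠ 0) (hp1 : ‖p‖ < 1) {k : ℂ} (hk : k ≠ 0) :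
    ∃ X Y : ℂ → ℂ, ∀ a ≠ 0, ∃ α β : ℂ, ∀ x ≠ 0,
      ellTheta (a * x) p * ellTheta (k * a / x) p = α * X x + β * Y x := by
  obtain ⟨C, hC⟩ := exists_ellTheta_eq_tsum hp0 hp1
  refine ⟨fun x => ∑' j : ℤ, p ^ (j ^ 2) * k ^ (-j) * x ^ (2 * j),
    fun x => ∑' j : ℤ, p ^ (j ^ 2 + j) * k ^ (-j) * x ^ (2 * j + 1), fun a ha =>
    ⟨C * C * ∑' l : ℤ, p ^ (l ^ 2 - l) * a ^ (2 * l) * k ^ l,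
      C * C * ∑' l : ℤ, -p ^ (l ^ 2) * a ^ (2 * l + 1) * k ^ l, fun x hx => ?_⟩⟩
  have hax := mul_ne_zero ha hx
  have hkax := div_ne_zero (mul_ne_zero hk ha) hx
  have s1 := summable_norm_thetaTerm hp0 hp1 hax
  have s2 := summable_norm_thetaTerm hp0 hp1 hkax
  have hs : Summable fun z : ℤ × ℤ => thetaTerm p (a * x) z.1 * thetaTerm p (k * a / x) z.2 :=
    summable_mul_of_summable_norm s1 s2
  have hs' := intProdParityEquiv.summable_iff.2 hs
  have hl := hs'.comp_injective Sum.inl_injective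
  have hr := hs'.comp_injective Sum.inr_injective
  have hsplit (F G : ℤ → ℂ) (h : Summable fun z : ℤ × ℤ => F z.1 * G z.2) :
      ∑' z : ℤ × ℤ, F z.1 * G z.2 = (∑' l, F l) * ∑' j, G j := by
    rw [h.tsum_prod]
    simp only [tsum_mul_left, tsum_mul_right]
  have el : (((fun z : ℤ × ℤ => thetaTerm p (a * x) z.1 * thetaTerm p (k * a / x) z.2) ∘
      intProdParityEquiv) ∘ Sum.inl) = fun z : ℤ × ℤ =>
        (p ^ (z.1 ^ 2 - z.1) * a ^ (2 * z.1) * k ^ z.1) *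
          (p ^ (z.2 ^ 2) * k ^ (-z.2) * x ^ (2 * z.2)) := by
    ext z
    exact thetaTerm_mul_thetaTerm_even hp0 hk ha hx z.1 z.2
  have er : (((fun z : ℤ × ℤ => thetaTerm p (a * x) z.1 * thetaTerm p (k * a / x) z.2) ∘
      intProdParityEquiv) ∘ Sum.inr) = fun z : ℤ × ℤ =>
        (-p ^ (z.1 ^ 2) * a ^ (2 * z.1 + 1) * k ^ z.1) *
          (p ^ (z.2 ^ 2 + z.2) * k ^ (-z.2) * x ^ (2 * z.2 + 1)) := by
    ext z
    exact thetaTerm_mul_thetaTerm_odd hp0 hk ha hx z.1 z.2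
  have hsum := hl.hasSum.sum hr.hasSum
  rw [el] at hl
  rw [er] at hr
  rw [el, er, hsplit (fun l => p ^ (l ^ 2 - l) * a ^ (2 * l) * k ^ l)
    (fun j => p ^ (j ^ 2) * k ^ (-j) * x ^ (2 * j)) hl,
    hsplit (fun l => -p ^ (l ^ 2) * a ^ (2 * l + 1) * k ^ l)
    (fun j => p ^ (j ^ 2 + j) * k ^ (-j) * x ^ (2 * j + 1)) hr] at hsum
  have hprod := tsum_mul_tsum_of_summable_norm s1 s2
  rw [← intProdParityEquiv.tsum_eq] at hprod
  rw [hC _ hax, hC _ hkax]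
  have := hprod.trans hsum.tsum_eq
  linear_combination (C * C) * this

end RankTwo

section BinaryForms

variable {τ : Type*}

/-- The span of the monomials of degree `m` in two functions `X` and `Y`. -/
noncomputable def binaryForms (X Y : τ → ℂ) (m : ℕ) : Submodule ℂ (τ → ℂ) :=
  Submodule.span ℂ (Set.range fun j : Fin (m + 1) => X ^ (j : ℕ) * Y ^ (j.rev : ℕ))

theorem mul_mem_binaryForms {X Y f : τ → ℂ} {m : ℕ} (hf : f ∈ binaryForms X Y m) (α β : ℂ) :
    (α • X + β • Y) * f ∈ binaryForms X Y (m + 1) := by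
  have hX : ∀ g ∈ binaryForms X Y m, X * g ∈ binaryForms X Y (m + 1) := fun g hg => by
    refine (Submodule.span_le.2 ?_ : binaryForms X Y m ≤
      (binaryForms X Y (m + 1)).comap (LinearMap.mulLeft ℂ X)) hg
    rintro _ ⟨j, rfl⟩
    refine Submodule.subset_span ⟨j.succ, ?_⟩
    simp [Fin.rev_succ, pow_succ']
    ring
  have hY : ∀ g ∈ binaryForms X Y m, Y * g ∈ binaryForms X Y (m + 1) := fun g hg => by
    refine (Submodule.span_le.2 ?_ : binaryForms X Y m ≤
      (binaryForms X Y (m + 1)).comap (LinearMap.mulLeft ℂ Y)) hg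
    rintro _ ⟨j, rfl⟩
    refine Submodule.subset_span ⟨j.castSucc, ?_⟩
    simp only [Fin.rev_castSucc, Fin.val_succ, Fin.val_castSucc, LinearMap.mulLeft_apply]
    ring
  rw [add_mul, smul_mul_assoc, smul_mul_assoc]
  exact add_mem (Submodule.smul_mem _ _ (hX f hf)) (Submodule.smul_mem _ _ (hY f hf))

theorem prod_mem_binaryForms (X Y : τ → ℂ) {m : ℕ} (α β : Fin m → ℂ) :
    ∏ i, (α i • X + β i • Y) ∈ binaryForms X Y m := by
  induction m with
  | zero => exact Submodule.subset_span ⟨0, by simp⟩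
  | succ m ih =>
    rw [Fin.prod_univ_succ]
    exact mul_mem_binaryForms (ih _ _) _ _

/-- A binary form of degree `m` with `m + 1` distinct projective zeros vanishes. -/
theorem eq_zero_of_mem_binaryForms {X Y f : τ → ℂ} {m : ℕ} (hf : f ∈ binaryForms X Y m)
    (x : Fin (m + 1) → τ) (hx : ∀ i j, i ≠ j → X (x j) * Y (x i) - X (x i) * Y (x j) ≠ 0)
    (h0 : ∀ i, f (x i) = 0) : f = 0 := by
  obtain ⟨q, hq⟩ := (Submodule.mem_span_range_iff_exists_fun ℂ).1 hf
  have hdet : (Matrix.projVandermonde (X ∘ x) (Y ∘ x)).det ≠ 0 := by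
    rw [Matrix.det_projVandermonde]
    exact Finset.prod_ne_zero_iff.2 fun i _ => Finset.prod_ne_zero_iff.2 fun j hj =>
      hx i j (Finset.mem_Ioi.1 hj).ne
  have hq0 : q = 0 := by
    refine Matrix.eq_zero_of_mulVec_eq_zero hdet ?_
    ext i
    have := h0 i
    rw [← hq] at this
    simpa [Matrix.mulVec, dotProduct, Matrix.projVandermonde_apply, mul_comm] using this
  rw [← hq, hq0]
  simp

end BinaryForms

section ThetaSum

variable {p t : ℂ} {n : ℕ}

/-- The cross terms of the summand. -/
noncomputable def thetaCross (p t : ℂ) (y : Fin n → ℂ) : ℂ :=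
  ∏ i, ∏ j, if i < j then ellTheta (t * y i * y j) p / ellTheta (y i * y j) p else 1

/-- The summand attached to a choice of signs, as a function of `y i = z i ^ σ i`. -/
noncomputable def thetaSummand (p t a b c d : ℂ) (y : Fin n → ℂ) : ℂ :=
  (∏ i, ellTheta (a * y i) p * ellTheta (b * y i) p * ellTheta (c * y i) p *
    ellTheta (d * y i) p / ellTheta (y i ^ 2) p) * thetaCross p t y

/-- The sum over all choices of signs. -/
noncomputable def thetaSum (p t a b c d : ℂ) (z : Fin n → ℂ) : ℂ :=
  ∑ σ : Fin n → Bool, thetaSummand p t a b c d fun i => pw (z i) (σ i)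

/-- No denominator of the sum vanishes. -/
structure ThetaRegular (p : ℂ) (z : Fin n → ℂ) : Prop where
  ne_zero : ∀ i, z i ≠ 0
  sq_ne_zero : ∀ i s, ellTheta (pw (z i) s ^ 2) p ≠ 0
  mul_ne_zero : ∀ i j, i ≠ j → ∀ s s', ellTheta (pw (z i) s * pw (z j) s') p ≠ 0

theorem pw_ne_zero {w : ℂ} (hw : w ≠ 0) (s : Bool) : pw w s ≠ 0 := by
  cases s <;> simp [pw, hw]

theorem pw_inv (w : ℂ) (s : Bool) : (pw w s)⁻¹ = pw w (!s) := by
  cases s <;> simp [pw]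

theorem thetaCross_insertNth (m : Fin (n + 1)) (w : ℂ) (y : Fin n → ℂ) :
    thetaCross p t (m.insertNth w y : Fin (n + 1) → ℂ) =
      (∏ i, ellTheta (t * w * y i) p / ellTheta (w * y i) p) * thetaCross p t y := by
  unfold thetaCross
  rw [Fin.prod_univ_succAbove _ m, Fin.prod_univ_succAbove _ m]
  simp only [Fin.prod_univ_succAbove _ m, Fin.insertNth_apply_same, Fin.insertNth_apply_succAbove,
    lt_irrefl, if_false, one_mul, Finset.prod_mul_distrib, Fin.succAbove_lt_succAbove_iff]
  rw [← mul_assoc, ← Finset.prod_mul_distrib]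
  congr 1
  refine Finset.prod_congr rfl fun i _ => ?_
  rcases lt_or_gt_of_ne (Fin.succAbove_ne m i) with h | h
  · rw [if_pos h, if_neg h.not_gt, one_mul, mul_right_comm, mul_comm w]
  · rw [if_pos h, if_neg h.not_gt, mul_one]

theorem thetaSummand_insertNth_self {a b c d : ℂ} (m : Fin (n + 1)) (y : Fin n → ℂ)
    (ha : ellTheta (a ^ 2) p ≠ 0) (hy : ∀ i, ellTheta (a * y i) p ≠ 0) :
    thetaSummand p t a b c d (m.insertNth a y : Fin (n + 1) → ℂ) =
      ellTheta (a * b) p * ellTheta (a * c) p * ellTheta (a * d) p *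
        thetaSummand p t (t * a) b c d y := by
  unfold thetaSummand
  rw [thetaCross_insertNth, Fin.prod_univ_succAbove _ m]
  simp only [Fin.insertNth_apply_same, Fin.insertNth_apply_succAbove]
  rw [← sq, mul_comm b a, mul_comm c a, mul_comm d a]
  have h : (∏ i, ellTheta (a * y i) p * ellTheta (b * y i) p * ellTheta (c * y i) p *
      ellTheta (d * y i) p / ellTheta (y i ^ 2) p) *
      (∏ i, ellTheta (t * a * y i) p / ellTheta (a * y i) p) =
      ∏ i, ellTheta (t * a * y i) p * ellTheta (b * y i) p * ellTheta (c * y i) p *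
        ellTheta (d * y i) p / ellTheta (y i ^ 2) p := by
    rw [← Finset.prod_mul_distrib]
    refine Finset.prod_congr rfl fun i _ => ?_
    have := hy i
    field_simp
  rw [← h]
  field_simp

theorem thetaSummand_insertNth_inv (hp1 : ‖p‖ < 1) {a b c d : ℂ} (ha : a ≠ 0) (m : Fin (n + 1))
    (y : Fin n → ℂ) : thetaSummand p t a b c d (m.insertNth a⁻¹ y : Fin (n + 1) → ℂ) = 0 := by
  unfold thetaSummand
  rw [Fin.prod_univ_succAbove _ m]
  simp [ha, ellTheta_one hp1]

/-- If one parameter equals `z m ^ ε`, the sum reduces to one with a variable less. -/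
theorem thetaSum_specialize (hp1 : ‖p‖ < 1) {b c d : ℂ} {z : Fin (n + 1) → ℂ}
    (hz : ThetaRegular p z) (m : Fin (n + 1)) (ε : Bool) :
    thetaSum p t (pw (z m) ε) b c d z =
      ellTheta (pw (z m) ε * b) p * ellTheta (pw (z m) ε * c) p * ellTheta (pw (z m) ε * d) p *
        thetaSum p t (t * pw (z m) ε) b c d fun i => z (m.succAbove i) := by
  unfold thetaSum
  have key (s : Bool) (σ : Fin n → Bool) :
      (fun i => pw (z i) ((m.insertNth s σ : Fin (n + 1) → Bool) i)) =
        (m.insertNth (pw (z m) s) fun i => pw (z (m.succAbove i)) (σ i) : Fin (n + 1) → ℂ) := by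
    refine (Fin.insertNth_eq_iff.2 ⟨?_, ?_⟩).symm
    · simp
    · ext i
      simp [Fin.removeNth]
  rw [← (Fin.insertNthEquiv (fun _ => Bool) m).sum_comp, Fintype.sum_prod_type,
    Finset.sum_eq_single ε]
  · rw [Finset.mul_sum]
    refine Finset.sum_congr rfl fun σ _ => ?_
    simp only [Fin.insertNthEquiv_apply, key]
    exact thetaSummand_insertNth_self m _ (hz.sq_ne_zero m ε)
      fun i => hz.mul_ne_zero _ _ (Fin.succAbove_ne m i).symm _ _
  · intro s _ hs
    refine Finset.sum_eq_zero fun σ _ => ?_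
    simp only [Fin.insertNthEquiv_apply, key]
    rw [show pw (z m) s = (pw (z m) ε)⁻¹ by rw [pw_inv, Bool.eq_not.2 hs]]
    exact thetaSummand_insertNth_inv hp1 (pw_ne_zero (hz.ne_zero m) ε) m _
  · simp

/-- The right-hand side of the summation formula. -/
noncomputable def thetaEval (p t a b c d : ℂ) (n : ℕ) : ℂ :=
  ∏ i ∈ Finset.range n, ellTheta (t ^ i * (a * b)) p * ellTheta (t ^ i * (a * c)) p *
    ellTheta (t ^ i * (a * d)) p

theorem thetaEval_succ (a b c d : ℂ) :
    thetaEval p t a b c d (n + 1) =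
      ellTheta (a * b) p * ellTheta (a * c) p * ellTheta (a * d) p *
        thetaEval p t (t * a) b c d n := by
  rw [thetaEval, Finset.prod_range_succ', mul_comm]
  simp only [pow_zero, one_mul, thetaEval, pow_succ, mul_assoc]

theorem ThetaRegular.succAbove {z : Fin (n + 1) → ℂ} (hz : ThetaRegular p z) (m : Fin (n + 1)) :
    ThetaRegular p fun i => z (m.succAbove i) where
  ne_zero _ := hz.ne_zero _
  sq_ne_zero _ := hz.sq_ne_zero _
  mul_ne_zero _ _ hij := hz.mul_ne_zero _ _ (Fin.succAbove_right_injective.ne hij)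

/-- The points `z m ^ ε` for distinct pairs `(m, ε)` are inequivalent modulo powers of `p`. -/
theorem ThetaRegular.inv_mul_ne_zero {z : Fin n → ℂ} (hz : ThetaRegular p z)
    {e e' : Fin n × Bool} (h : e ≠ e') :
    ellTheta ((pw (z e.1) e.2)⁻¹ * pw (z e'.1) e'.2) p ≠ 0 := by
  rw [pw_inv]
  by_cases h1 : e.1 = e'.1
  · have h2 : (!e.2) = e'.2 := by
      rw [Bool.not_eq_eq_eq_not, Bool.eq_not]
      exact fun h2 => h (Prod.ext h1 h2)
    rw [h1, h2, ← sq]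
    exact hz.sq_ne_zero _ _
  · exact hz.mul_ne_zero _ _ h1 _ _

theorem theta_pair_prod_mem_binaryForms {k : ℂ} {X Y : ℂ → ℂ}
    (hXY : ∀ a ≠ 0, ∃ α β : ℂ, ∀ x ≠ 0,
      ellTheta (a * x) p * ellTheta (k * a / x) p = α * X x + β * Y x)
    {y : Fin n → ℂ} (hy : ∀ i, y i ≠ 0) :
    (fun x : {x : ℂ // x ≠ 0} => ∏ i, ellTheta (y i * x) p * ellTheta (k * y i / x) p) ∈
      binaryForms (fun x => X x.1) (fun x => Y x.1) n := by
  choose α β h using fun i => hXY (y i) (hy i)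
  convert prod_mem_binaryForms (fun x : {x : ℂ // x ≠ 0} => X x.1) (fun x => Y x.1) α β using 1
  ext x
  simp [h _ x.1 x.2]

/-- Both sides of the summation formula are determined, for fixed `a * b = k`, by their values at
sufficiently many inequivalent values of `a`. -/
theorem thetaSum_eq_of_specializations (hp0 : p ≠ 0) (hp1 : ‖p‖ < 1) {a b c d : ℂ} (ht : t ≠ 0)
    (ha : a ≠ 0) (hb : b ≠ 0) (hc : c ≠ 0) (hd : d ≠ 0) {z : Fin (n + 1) → ℂ}
    (hz : ThetaRegular p z) (hbal : t ^ n * (a * b * c * d) = p)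
    (hgen : ∀ e e' : Fin (n + 1) × Bool,
      ellTheta (a * b * pw (z e.1) e.2 * pw (z e'.1) e'.2) p ≠ 0)
    (hspec : ∀ m ε, thetaSum p t (pw (z m) ε) (a * b / pw (z m) ε) c d z =
      thetaEval p t (pw (z m) ε) (a * b / pw (z m) ε) c d (n + 1)) :
    thetaSum p t a b c d z = thetaEval p t a b c d (n + 1) := by
  set k := a * b with hk
  have hk0 : k ≠ 0 := mul_ne_zero ha hb
  obtain ⟨X, Y, hXY⟩ := exists_theta_pair_basis hp0 hp1 hk0
  let L : {x : ℂ // x ≠ 0} → ℂ := fun x => thetaSum p t x (k / x) c d z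
  let R : {x : ℂ // x ≠ 0} → ℂ := fun x => thetaEval p t x (k / x) c d (n + 1)
  have hL : L ∈ binaryForms (fun x => X x.1) (fun x => Y x.1) (n + 1) := by
    have : L = ∑ σ : Fin (n + 1) → Bool,
        ((∏ i, ellTheta (c * pw (z i) (σ i)) p * ellTheta (d * pw (z i) (σ i)) p /
          ellTheta (pw (z i) (σ i) ^ 2) p) * thetaCross p t fun i => pw (z i) (σ i)) •
        fun x : {x : ℂ // x ≠ 0} => ∏ i, ellTheta (pw (z i) (σ i) * x) p *
          ellTheta (k * pw (z i) (σ i) / x) p := by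
      ext x
      simp only [L, thetaSum, thetaSummand, Finset.sum_apply, Pi.smul_apply, smul_eq_mul]
      refine Finset.sum_congr rfl fun σ _ => ?_
      rw [mul_right_comm, ← Finset.prod_mul_distrib]
      congr 1
      refine Finset.prod_congr rfl fun i _ => ?_
      rw [div_mul_eq_mul_div, mul_comm (x : ℂ)]
      ring
    rw [this]
    exact Submodule.sum_mem _ fun σ _ => Submodule.smul_mem _ _
      (theta_pair_prod_mem_binaryForms hXY fun i => pw_ne_zero (hz.ne_zero i) _)
  have hR : R ∈ binaryForms (fun x => X x.1) (fun x => Y x.1) (n + 1) := by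
    have : R = (∏ i ∈ Finset.range (n + 1), ellTheta (t ^ i * k) p) •
        fun x : {x : ℂ // x ≠ 0} => ∏ i : Fin (n + 1), ellTheta (t ^ (i : ℕ) * c * x) p *
          ellTheta (k * (t ^ (i : ℕ) * c) / x) p := by
      ext ⟨x, hx⟩
      simp only [R, thetaEval, Pi.smul_apply, smul_eq_mul, mul_div_cancel₀ k hx,
        Finset.prod_mul_distrib, mul_assoc]
      rw [Fin.prod_univ_eq_prod_range fun i => ellTheta (t ^ i * (c * x)) p,
        Fin.prod_univ_eq_prod_range fun i => ellTheta (k * (t ^ i * c) / x) p,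
        ← Finset.prod_range_reflect fun i => ellTheta (k * (t ^ i * c) / x) p]
      simp only [mul_comm c x]
      congr 2
      refine Finset.prod_congr rfl fun i hi => ?_
      have hi : i ≤ n := Nat.lt_succ_iff.1 (Finset.mem_range.1 hi)
      rw [← ellTheta_div_self hp0 (mul_ne_zero (pow_ne_zero i ht) (mul_ne_zero hx hd)),
        Nat.add_sub_cancel]
      congr 1
      rw [← hbal, ← pow_sub_mul_pow t hi]
      have := pow_ne_zero i ht
      field_simp
    rw [this]
    exact Submodule.smul_mem _ _ (theta_pair_prod_mem_binaryForms hXY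
      fun i => mul_ne_zero (pow_ne_zero _ ht) hc)
  let e : Fin (n + 1 + 1) → Fin (n + 1) × Bool := Fin.cons (0, false) fun i => (i, true)
  have he : Function.Injective e := by
    refine Fin.cons_injective_iff.2 ⟨by simp, fun i j h => (Prod.ext_iff.1 h).1⟩
  let x : Fin (n + 1 + 1) → {x : ℂ // x ≠ 0} := fun i =>
    ⟨pw (z (e i).1) (e i).2, pw_ne_zero (hz.ne_zero _) _⟩
  have hvanish : L - R = 0 := by
    refine eq_zero_of_mem_binaryForms (sub_mem hL hR) x (fun i j hij hdet => ?_)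
      fun i => sub_eq_zero.2 (hspec _ _)
    have hzero (i) : ellTheta ((x i : ℂ)⁻¹ * x i) p = 0 := by
      rw [inv_mul_cancel₀ (x i).2, ellTheta_one hp1]
    have hne (i j) (hij : i ≠ j) :
        ellTheta ((x i : ℂ)⁻¹ * x j) p * ellTheta (k * (x i : ℂ)⁻¹ / x j) p ≠ 0 := by
      refine mul_ne_zero (hz.inv_mul_ne_zero (he.ne hij)) ?_
      simp only [x]
      rw [div_eq_mul_inv, pw_inv, pw_inv]
      exact hgen (_, _) (_, _)
    obtain ⟨α, β, h1⟩ := hXY _ (inv_ne_zero (x i).2)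
    obtain ⟨α', β', h2⟩ := hXY _ (inv_ne_zero (x j).2)
    have h1i := h1 _ (x i).2
    have h2j := h2 _ (x j).2
    rw [hzero, zero_mul] at h1i h2j
    have hij' := mul_ne_zero (hne i j hij) (hne j i hij.symm)
    rw [h1 _ (x j).2, h2 _ (x i).2] at hij'
    refine hij' ?_
    linear_combination (α * β' - β * α') * hdet - (α' * X (x j) + β' * Y (x j)) * h1i
  have := congrFun (sub_eq_zero.1 hvanish) ⟨a, ha⟩
  have hba : k / a = b := by rw [hk, mul_div_cancel_left₀ b ha]
  simpa only [L, R, hba] using this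

theorem continuousOn_ellTheta_comp (hp1 : ‖p‖ < 1) {f : ℂ → ℂ} {S : Set ℂ}
    (hf : ContinuousOn f S) (h0 : ∀ s ∈ S, f s ≠ 0) : ContinuousOn (fun s => ellTheta (f s) p) S :=
  (continuousOn_ellTheta hp1).comp hf h0

theorem thetaSum_eq_thetaEval (hp0 : p ≠ 0) (hp1 : ‖p‖ < 1) (ht : t ≠ 0) {a b c d : ℂ}
    (ha : a ≠ 0) (hb : b ≠ 0) (hc : c ≠ 0) (hd : d ≠ 0) {z : Fin n → ℂ}
    (hz : ThetaRegular p z) (hbal : t ^ n * (a * b * c * d) = p * t) :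
    thetaSum p t a b c d z = thetaEval p t a b c d n := by
  induction n generalizing a b c d with
  | zero => simp [thetaSum, thetaSummand, thetaCross, thetaEval]
  | succ n ih =>
    have hid : ContinuousOn (fun s : ℂ => s) {0}ᶜ := continuousOn_id
    have hbs : ContinuousOn (fun s : ℂ => b * s) {0}ᶜ := continuousOn_const.mul hid
    have hds : ContinuousOn (fun s : ℂ => d / s) {0}ᶜ := continuousOn_const.div hid fun s hs => hs
    have hF : ContinuousOn (fun s => thetaSum p t a (b * s) c (d / s) z) {0}ᶜ := by
      unfold thetaSum thetaSummand
      refine continuousOn_finsetSum _ fun σ _ => (continuousOn_finsetProd _ fun i _ => ?_).mul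
        continuousOn_const
      have hy := pw_ne_zero (hz.ne_zero i) (σ i)
      exact (((continuousOn_const.mul (continuousOn_ellTheta_comp hp1 (hbs.mul continuousOn_const)
        fun s hs => mul_ne_zero (mul_ne_zero hb hs) hy)).mul continuousOn_const).mul
        (continuousOn_ellTheta_comp hp1 (hds.mul continuousOn_const)
        fun s hs => mul_ne_zero (div_ne_zero hd hs) hy)).div_const _
    have hG : ContinuousOn (fun s => thetaEval p t a (b * s) c (d / s) (n + 1)) {0}ᶜ := by
      unfold thetaEval
      refine continuousOn_finsetProd _ fun i _ => ?_
      have hti := pow_ne_zero i ht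
      exact ((continuousOn_ellTheta_comp hp1 (continuousOn_const.mul (continuousOn_const.mul hbs))
        fun s hs => mul_ne_zero hti (mul_ne_zero ha (mul_ne_zero hb hs))).mul
        continuousOn_const).mul
        (continuousOn_ellTheta_comp hp1 (continuousOn_const.mul (continuousOn_const.mul hds))
        fun s hs => mul_ne_zero hti (mul_ne_zero ha (div_ne_zero hd hs)))
    let B : Set ℂ := {0} ∪ ⋃ q : (Fin (n + 1) × Bool) × (Fin (n + 1) × Bool),
      {s : ℂ | s ≠ 0 ∧
        ellTheta (a * b * pw (z q.1.1) q.1.2 * pw (z q.2.1) q.2.2 * s) p = 0}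
    have hB : B.Countable := (Set.countable_singleton 0).union <| Set.countable_iUnion fun q =>
      countable_ellTheta_mul_eq_zero hp1 (mul_ne_zero (mul_ne_zero (mul_ne_zero ha hb)
        (pw_ne_zero (hz.ne_zero _) _)) (pw_ne_zero (hz.ne_zero _) _))
    have hEq : Set.EqOn (fun s => thetaSum p t a (b * s) c (d / s) z)
        (fun s => thetaEval p t a (b * s) c (d / s) (n + 1)) Bᶜ := by
      intro s hs
      have hs0 : s ≠ 0 := fun h => hs (.inl h)
      have hbs0 := mul_ne_zero hb hs0
      have hds0 := div_ne_zero hd hs0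
      have hbal' : t ^ n * (a * (b * s) * c * (d / s)) = p := by
        refine mul_right_cancel₀ ht ?_
        rw [← hbal]
        field_simp
        ring
      refine thetaSum_eq_of_specializations hp0 hp1 ht ha hbs0 hc hds0 hz hbal'
        (fun e e' h => hs (.inr (Set.mem_iUnion.2 ⟨(e, e'), hs0, ?_⟩))) fun m ε => ?_
      · rw [← h]
        congr 1
        ring
      · have hw := pw_ne_zero (hz.ne_zero m) ε
        rw [thetaSum_specialize hp1 hz, thetaEval_succ,
          ih (mul_ne_zero ht hw) (div_ne_zero (mul_ne_zero ha hbs0) hw) hc hds0 (hz.succAbove m)]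
        rw [← hbal']
        field_simp
    have hB0 : Bᶜ ⊆ ({0}ᶜ : Set ℂ) := Set.compl_subset_compl.2 Set.subset_union_left
    have h1 := hEq.of_subset_closure hF hG hB0
      (by rw [(hB.dense_compl ℂ).closure_eq]; exact Set.subset_univ _)
      (show (1 : ℂ) ∈ ({0}ᶜ : Set ℂ) by simp)
    simpa using h1

end ThetaSum

theorem thetaRegular_of_ne_zero {p : ℂ} (hp1 : ‖p‖ < 1) {n : ℕ} {z : Fin n → ℂ}
    (hz0 : ∀ i, z i ≠ 0) (hz2 : ∀ i, ellTheta (z i ^ 2) p ≠ 0)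
    (hzij : ∀ i j, i < j → ellTheta (z i * z j) p ≠ 0 ∧ ellTheta (z i / z j) p ≠ 0) :
    ThetaRegular p z where
  ne_zero := hz0
  sq_ne_zero i s := by
    cases s
    · simpa [pw] using ellTheta_inv_ne_zero hp1 (pow_ne_zero 2 (hz0 i)) (hz2 i)
    · simpa [pw] using hz2 i
  mul_ne_zero i j hij s s' := by
    wlog h : i < j generalizing i j s s'
    · rw [mul_comm]
      exact this j i hij.symm s' s (hij.lt_or_gt.resolve_left h)
    obtain ⟨h1, h2⟩ := hzij i j h
    have h3 := ellTheta_inv_ne_zero hp1 (mul_ne_zero (hz0 i) (hz0 j)) h1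
    have h4 := ellTheta_inv_ne_zero hp1 (div_ne_zero (hz0 i) (hz0 j)) h2
    rw [mul_inv] at h3
    rw [inv_div, div_eq_inv_mul] at h4
    rw [div_eq_mul_inv] at h2
    cases s <;> cases s' <;> simpa [pw]

/-- Lemma (the theta-function summation behind the difference operators). -/
theorem diffeq_norm (n : ℕ) (hn : 1 ≤ n) (p : ℂ)
    (hp0 : 0 < ‖p‖) (hp1 : ‖p‖ < 1)
    (t : ℂ) (u : Fin 4 → ℂ) (z : Fin n → ℂ)
    (ht0 : t ≠ 0) (hu0 : ∀ r, u r ≠ 0) (hz0 : ∀ i, z i ≠ 0)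
    (hbal : t ^ (n - 1) * (u 0 * u 1 * u 2 * u 3) = p)
    (hz2 : ∀ i, ellTheta (z i ^ 2) p ≠ 0)
    (hzij : ∀ i j, i < j → ellTheta (z i * z j) p ≠ 0 ∧ ellTheta (z i / z j) p ≠ 0) :
    (∑ σ : Fin n → Bool,
      (∏ i, (∏ r, ellTheta (u r * pw (z i) (σ i)) p) / ellTheta (pw (z i) (σ i) ^ 2) p) *
        ∏ i, ∏ j, if i < j then
          ellTheta (t * pw (z i) (σ i) * pw (z j) (σ j)) p /
            ellTheta (pw (z i) (σ i) * pw (z j) (σ j)) p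
        else 1) =
      ∏ i ∈ Finset.range n,
        ellTheta (t ^ i * (u 0 * u 1)) p * ellTheta (t ^ i * (u 0 * u 2)) p *
          ellTheta (t ^ i * (u 0 * u 3)) p := by
  have hp : p ≠ 0 := norm_pos_iff.1 hp0
  have hz := thetaRegular_of_ne_zero hp1 hz0 hz2 hzij
  have hbal' : t ^ n * (u 0 * u 1 * u 2 * u 3) = p * t := by
    rw [← hbal, mul_right_comm (t ^ (n - 1)) _ t, pow_sub_one_mul (Nat.one_le_iff_ne_zero.1 hn)]
  have h := thetaSum_eq_thetaEval hp hp1 ht0 (hu0 0) (hu0 1) (hu0 2) (hu0 3) hz hbal'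
  simpa only [thetaSum, thetaSummand, thetaCross, thetaEval, Fin.prod_univ_four] using h
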